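/- Let G be the subgroup of GL(4,ℂ) generated by {diag(𝔖, (𝔖⁻¹)†) : 𝔖 ∈ SL(2,ℂ)} together with γ₀ and γ₁γ₂γ₃. For every matrix S in the full Lorentz group O(1,3,ℝ) there exists Ŝ ∈ G such that Ŝ · γ_m · Ŝ⁻¹ = Σ_{k=0}^{3} S^k_m · γ_k for all m = 0,1,2,3, and this Ŝ is unique up to sign: if Ŝ' ∈ G satisfies the same relations then Ŝ' = Ŝ or Ŝ' = -Ŝ. -/

import Mathlib

open Matrix Complex

noncomputable section

/-- The Pauli matrices σ₀, σ₁, σ₂, σ₃. -/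
def Pauli : Fin 4 → Matrix (Fin 2) (Fin 2) ℂ :=
  ![!![1, 0; 0, 1], !![0, 1; 1, 0], !![0, -I; I, 0], !![1, 0; 0, -1]]

/-- The tilde Pauli matrices: σ̃₀ = σ₀ and σ̃ₘ = -σₘ for m = 1,2,3. -/
def PauliT : Fin 4 → Matrix (Fin 2) (Fin 2) ℂ :=
  ![!![1, 0; 0, 1], -!![0, 1; 1, 0], -!![0, -I; I, 0], -!![1, 0; 0, -1]]

/-- The Dirac matrices γₘ = [[0, σₘ],[σ̃ₘ, 0]] in 2×2-block form, written out as 4×4 matrices. -/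
def Dirac : Fin 4 → Matrix (Fin 4) (Fin 4) ℂ :=
  ![!![0, 0, 1, 0; 0, 0, 0, 1; 1, 0, 0, 0; 0, 1, 0, 0],
    !![0, 0, 0, 1; 0, 0, 1, 0; 0, -1, 0, 0; -1, 0, 0, 0],
    !![0, 0, 0, -I; 0, 0, I, 0; 0, I, 0, 0; -I, 0, 0, 0],
    !![0, 0, 1, 0; 0, 0, 0, -1; -1, 0, 0, 0; 0, 1, 0, 0]]

/-- The Minkowski metric matrix g = diag(1,-1,-1,-1). -/
def etaMink : Matrix (Fin 4) (Fin 4) ℝ := !![1,0,0,0; 0,-1,0,0; 0,0,-1,0; 0,0,0,-1]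

/-- The defining relation of the homomorphism φ: 𝔖 σₘ 𝔖† = Σₖ Sᵏₘ σₖ. -/
def IsPhi (𝔖 : Matrix (Fin 2) (Fin 2) ℂ) (S : Matrix (Fin 4) (Fin 4) ℝ) : Prop :=
  ∀ m : Fin 4, 𝔖 * Pauli m * 𝔖ᴴ = ∑ k : Fin 4, (S k m : ℂ) • Pauli k

/-- The block-diagonal matrix Ŝ = diag(𝔖, (𝔖⁻¹)†). -/
def hatM (A : Matrix (Fin 2) (Fin 2) ℂ) : Matrix (Fin 4) (Fin 4) ℂ :=
  !![A 0 0, A 0 1, 0, 0;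
     A 1 0, A 1 1, 0, 0;
     0, 0, ((A⁻¹)ᴴ) 0 0, ((A⁻¹)ᴴ) 0 1;
     0, 0, ((A⁻¹)ᴴ) 1 0, ((A⁻¹)ᴴ) 1 1]

/-- The generating set in GL(4,ℂ): all matrices diag(𝔖,(𝔖⁻¹)†) for 𝔖 ∈ SL(2,ℂ)
together with the two matrices a and b. -/
def genSet (a b : Matrix (Fin 4) (Fin 4) ℂ) :
    Set (Matrix.GeneralLinearGroup (Fin 4) ℂ) :=
  {g | (∃ 𝔖 : Matrix (Fin 2) (Fin 2) ℂ, 𝔖.det = 1 ∧ g.val = hatM 𝔖) ∨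
        g.val = a ∨ g.val = b}

/-- The group generated by the block-diagonal matrices together with the space and time
inversions. -/
abbrev diracGroup : Subgroup (Matrix.GeneralLinearGroup (Fin 4) ℂ) :=
  Subgroup.closure (genSet (Dirac 0) (Dirac 1 * Dirac 2 * Dirac 3))

lemma hatM_eq_of_det_eq_one {A : Matrix (Fin 2) (Fin 2) ℂ} (h : A.det = 1) :
    hatM A = !![A 0 0, A 0 1, 0, 0;
                A 1 0, A 1 1, 0, 0;
                0, 0, star (A 1 1), -star (A 1 0);
                0, 0, -star (A 0 1), star (A 0 0)] := by
  simp [hatM, Matrix.inv_def, h, Matrix.adjugate_fin_two, Matrix.conjTranspose_apply]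

lemma det_hatM {A : Matrix (Fin 2) (Fin 2) ℂ} (h : A.det = 1) : (hatM A).det = 1 := by
  have h1 := h
  rw [Matrix.det_fin_two] at h1
  have h2 := congrArg star h1
  simp only [star_sub, star_mul, star_one] at h2
  rw [hatM_eq_of_det_eq_one h]
  simp [Matrix.det_succ_row_zero, Fin.sum_univ_succ, Fin.succAbove] at h2 ⊢
  linear_combination h1 + (A 0 0 * A 1 1 - A 0 1 * A 1 0) * h2

lemma timeInversion_eq :
    Dirac 1 * Dirac 2 * Dirac 3 = !![0, 0, -I, 0; 0, 0, 0, -I; I, 0, 0, 0; 0, I, 0, 0] := by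
  ext i j
  fin_cases i <;> fin_cases j <;> simp [Dirac, Matrix.mul_apply, Fin.sum_univ_four]

lemma det_dirac_zero : (Dirac 0).det = 1 := by
  simp [Dirac, Matrix.det_succ_row_zero, Fin.sum_univ_succ, Fin.succAbove]

lemma det_timeInversion : (Dirac 1 * Dirac 2 * Dirac 3).det = 1 := by
  rw [timeInversion_eq]
  simp [Matrix.det_succ_row_zero, Fin.sum_univ_succ, Fin.succAbove]

lemma exists_mem_diracGroup_val {M : Matrix (Fin 4) (Fin 4) ℂ} (hdet : M.det = 1)
    (h : (∃ A : Matrix (Fin 2) (Fin 2) ℂ, A.det = 1 ∧ M = hatM A) ∨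
      M = Dirac 0 ∨ M = Dirac 1 * Dirac 2 * Dirac 3) :
    ∃ g ∈ diracGroup, g.val = M :=
  ⟨Matrix.GeneralLinearGroup.mkOfDetNeZero M (by simp [hdet]), Subgroup.subset_closure h, rfl⟩

/-- The matrix of the quaternionic structure commuting with all Dirac matrices. -/
def quaternionicMatrix : Matrix (Fin 4) (Fin 4) ℂ :=
  !![0, 0, 0, 1; 0, 0, -1, 0; 0, 1, 0, 0; -1, 0, 0, 0]

lemma det_eq_one_and_quaternionic_of_mem {g : Matrix.GeneralLinearGroup (Fin 4) ℂ}
    (hg : g ∈ diracGroup) :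
    g.val.det = 1 ∧ g.val.map (starRingEnd ℂ) * quaternionicMatrix = quaternionicMatrix * g.val := by
  induction hg using Subgroup.closure_induction with
  | mem g hg =>
    rcases hg with ⟨A, hA, hgA⟩ | hg | hg
    · refine ⟨hgA ▸ det_hatM hA, ?_⟩
      rw [hgA, hatM_eq_of_det_eq_one hA]
      ext i j
      fin_cases i <;> fin_cases j <;>
        simp [quaternionicMatrix, Matrix.mul_apply, Fin.sum_univ_four]
    · refine ⟨hg ▸ det_dirac_zero, ?_⟩
      rw [hg]
      ext i j
      fin_cases i <;> fin_cases j <;>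
        simp [quaternionicMatrix, Dirac, Matrix.mul_apply, Fin.sum_univ_four]
    · refine ⟨hg ▸ det_timeInversion, ?_⟩
      rw [hg, timeInversion_eq]
      ext i j
      fin_cases i <;> fin_cases j <;>
        simp [quaternionicMatrix, Matrix.mul_apply, Fin.sum_univ_four]
  | one => simp
  | mul a b _ _ ha hb =>
    refine ⟨by simp [ha.1, hb.1], ?_⟩
    rw [Units.val_mul, Matrix.map_mul, mul_assoc, hb.2, ← mul_assoc, ha.2, mul_assoc]
  | inv a _ ha =>
    have hinv : a⁻¹.val.map (starRingEnd ℂ) * a.val.map (starRingEnd ℂ) = 1 := by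
      rw [← Matrix.map_mul, Units.inv_mul, Matrix.map_one _ (map_zero _) (map_one _)]
    refine ⟨?_, ?_⟩
    · have h := congrArg Matrix.det (Units.inv_mul a)
      rwa [Matrix.det_mul, ha.1, mul_one, Matrix.det_one] at h
    · rw [Units.eq_mul_inv_iff_mul_eq, mul_assoc, ← ha.2, ← mul_assoc, hinv, one_mul]

/-- The Minkowski bilinear form. -/
def minkowskiForm (x y : Fin 4 → ℝ) : ℝ := x 0 * y 0 - x 1 * y 1 - x 2 * y 2 - x 3 * y 3

/-- The Clifford image of a vector. -/
def slash (w : Fin 4 → ℝ) : Matrix (Fin 4) (Fin 4) ℂ := ∑ k : Fin 4, (w k : ℂ) • Dirac k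

lemma slash_eq (w : Fin 4 → ℝ) :
    slash w = !![0, 0, (w 0 + w 3 : ℂ), w 1 - I * w 2; 0, 0, w 1 + I * w 2, w 0 - w 3;
                 w 0 - w 3, -w 1 + I * w 2, 0, 0; -w 1 - I * w 2, w 0 + w 3, 0, 0] := by
  ext i j
  fin_cases i <;> fin_cases j <;> simp [slash, Dirac, Fin.sum_univ_four] <;> ring

lemma slash_mul_slash (v w : Fin 4 → ℝ) :
    slash v * slash w + slash w * slash v = ((2 * minkowskiForm v w : ℝ) : ℂ) • 1 := by
  have hI := I_sq
  ext i j
  rw [slash_eq, slash_eq]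
  fin_cases i <;> fin_cases j <;>
    simp [minkowskiForm] <;> grind

lemma exists_smul_slash_mem {w : Fin 4 → ℝ} (hw : minkowskiForm w w ≠ 0) :
    ∃ g ∈ diracGroup, ∃ c : ℂ, g.val = c • slash w := by
  obtain ⟨p, hp, hpv⟩ := exists_mem_diracGroup_val det_dirac_zero (.inr (.inl rfl))
  obtain ⟨t, ht, htv⟩ := exists_mem_diracGroup_val det_timeInversion (.inr (.inr rfl))
  rcases lt_or_gt_of_ne hw with hneg | hpos
  · let a : ℝ := (√(-minkowskiForm w w))⁻¹
    have ha2 : (a : ℂ) ^ 2 * (w 0 * w 0 - w 1 * w 1 - w 2 * w 2 - w 3 * w 3) = -1 := by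
      have h : a ^ 2 * minkowskiForm w w = -1 := by
        rw [inv_pow, Real.sq_sqrt (by linarith)]
        field_simp
      exact_mod_cast h
    let A : Matrix (Fin 2) (Fin 2) ℂ :=
      (I * a) • !![(w 0 + w 3 : ℂ), w 1 - I * w 2; w 1 + I * w 2, w 0 - w 3]
    have hA : A.det = 1 := by
      simp [A, Matrix.det_fin_two]
      grind [I_sq]
    obtain ⟨g, hg, hgv⟩ := exists_mem_diracGroup_val (det_hatM hA) (.inl ⟨A, hA, rfl⟩)
    refine ⟨p * t * g * p, mul_mem (mul_mem (mul_mem hp ht) hg) hp, -a, ?_⟩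
    rw [Units.val_mul, Units.val_mul, Units.val_mul, hpv, htv, hgv, timeInversion_eq,
      hatM_eq_of_det_eq_one hA, slash_eq]
    ext i j
    fin_cases i <;> fin_cases j <;>
      simp [A, Dirac, Matrix.mul_apply, Fin.sum_univ_four] <;> grind [I_sq]
  · let a : ℝ := (√(minkowskiForm w w))⁻¹
    have ha2 : (a : ℂ) ^ 2 * (w 0 * w 0 - w 1 * w 1 - w 2 * w 2 - w 3 * w 3) = 1 := by
      have h : a ^ 2 * minkowskiForm w w = 1 := by
        rw [inv_pow, Real.sq_sqrt hpos.le, inv_mul_cancel₀ hw]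
      exact_mod_cast h
    let A : Matrix (Fin 2) (Fin 2) ℂ :=
      (a : ℂ) • !![(w 0 + w 3 : ℂ), w 1 - I * w 2; w 1 + I * w 2, w 0 - w 3]
    have hA : A.det = 1 := by
      simp [A, Matrix.det_fin_two]
      grind [I_sq]
    obtain ⟨g, hg, hgv⟩ := exists_mem_diracGroup_val (det_hatM hA) (.inl ⟨A, hA, rfl⟩)
    refine ⟨g * p, mul_mem hg hp, a, ?_⟩
    rw [Units.val_mul, hpv, hgv, hatM_eq_of_det_eq_one hA, slash_eq]
    ext i j
    fin_cases i <;> fin_cases j <;>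
      simp [A, Dirac, Matrix.mul_apply, Fin.sum_univ_four] <;> grind [I_sq]

/-- Some element of the group intertwines the Clifford images of `x` and `f x`. -/
def Lifts (f : (Fin 4 → ℝ) →ₗ[ℝ] (Fin 4 → ℝ)) : Prop :=
  ∃ g ∈ diracGroup, ∀ x, g.val * slash x = slash (f x) * g.val

lemma Lifts.comp {f h : (Fin 4 → ℝ) →ₗ[ℝ] (Fin 4 → ℝ)} (hf : Lifts f) (hh : Lifts h) :
    Lifts (f ∘ₗ h) := by
  obtain ⟨a, ha, haf⟩ := hf
  obtain ⟨b, hb, hbh⟩ := hh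
  refine ⟨a * b, mul_mem ha hb, fun x => ?_⟩
  rw [Units.val_mul, mul_assoc, hbh, ← mul_assoc, haf, mul_assoc, LinearMap.comp_apply]

lemma lifts_id : Lifts LinearMap.id :=
  ⟨1, one_mem _, fun x => by simp⟩

lemma slash_add (v w : Fin 4 → ℝ) : slash (v + w) = slash v + slash w := by
  simp [slash, add_smul, Finset.sum_add_distrib]

lemma slash_smul (a : ℝ) (v : Fin 4 → ℝ) : slash (a • v) = (a : ℂ) • slash v := by
  simp [slash, Finset.smul_sum, mul_smul]

lemma slash_neg (v : Fin 4 → ℝ) : slash (-v) = -slash v := by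
  simp [slash]

lemma lifts_neg_id : Lifts (-LinearMap.id) := by
  obtain ⟨p, hp, hpv⟩ := exists_mem_diracGroup_val det_dirac_zero (.inr (.inl rfl))
  obtain ⟨t, ht, htv⟩ := exists_mem_diracGroup_val det_timeInversion (.inr (.inr rfl))
  refine ⟨p * t, mul_mem hp ht, fun x => ?_⟩
  rw [LinearMap.neg_apply, LinearMap.id_apply, slash_neg, Units.val_mul, hpv, htv,
    timeInversion_eq, slash_eq]
  ext i j
  fin_cases i <;> fin_cases j <;> simp [Dirac, Matrix.mul_apply, Fin.sum_univ_four] <;> ring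

lemma slash_mul_self (w : Fin 4 → ℝ) :
    slash w * slash w = ((minkowskiForm w w : ℝ) : ℂ) • 1 := by
  have h := slash_mul_slash w w
  rw [← two_smul ℂ, Complex.ofReal_mul, mul_smul] at h
  exact smul_right_injective _ (two_ne_zero (α := ℂ)) (by simpa using h)

/-- The reflection of Minkowski space in the hyperplane orthogonal to `w`. -/
def minkowskiReflection (w : Fin 4 → ℝ) : (Fin 4 → ℝ) →ₗ[ℝ] (Fin 4 → ℝ) where
  toFun x := x - (2 * minkowskiForm w x / minkowskiForm w w) • w
  map_add' x y := by
    ext i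
    simp [minkowskiForm]
    ring
  map_smul' a x := by
    ext i
    simp [minkowskiForm]
    ring

lemma minkowskiReflection_apply (w x : Fin 4 → ℝ) :
    minkowskiReflection w x = x - (2 * minkowskiForm w x / minkowskiForm w w) • w := rfl

lemma lifts_minkowskiReflection {w : Fin 4 → ℝ} (hw : minkowskiForm w w ≠ 0) :
    Lifts (minkowskiReflection w) := by
  have hneg : Lifts (-minkowskiReflection w) := by
    obtain ⟨g, hg, c, hgc⟩ := exists_smul_slash_mem hw
    refine ⟨g, hg, fun x => ?_⟩
    rw [hgc, LinearMap.neg_apply, minkowskiReflection_apply, smul_mul_assoc, mul_smul_comm,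
      neg_sub, sub_eq_add_neg, slash_add, slash_neg, slash_smul, add_mul, smul_mul_assoc,
      slash_mul_self, smul_smul, neg_mul, ← ofReal_mul, div_mul_cancel₀ _ hw,
      ← slash_mul_slash w x, add_neg_cancel_right]
  convert lifts_neg_id.comp hneg using 1
  ext : 1
  simp

lemma minkowskiForm_sub_left (x y z : Fin 4 → ℝ) :
    minkowskiForm (x - y) z = minkowskiForm x z - minkowskiForm y z := by
  simp [minkowskiForm]
  ring

lemma minkowskiForm_sub_right (x y z : Fin 4 → ℝ) :
    minkowskiForm x (y - z) = minkowskiForm x y - minkowskiForm x z := by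
  simp [minkowskiForm]
  ring

lemma minkowskiForm_smul_left (a : ℝ) (x y : Fin 4 → ℝ) :
    minkowskiForm (a • x) y = a * minkowskiForm x y := by
  simp [minkowskiForm]
  ring

lemma minkowskiForm_smul_right (a : ℝ) (x y : Fin 4 → ℝ) :
    minkowskiForm x (a • y) = a * minkowskiForm x y := by
  simp [minkowskiForm]
  ring

lemma minkowskiForm_comm (x y : Fin 4 → ℝ) : minkowskiForm x y = minkowskiForm y x := by
  simp [minkowskiForm, mul_comm]

lemma minkowskiForm_minkowskiReflection {w : Fin 4 → ℝ} (hw : minkowskiForm w w ≠ 0)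
    (x y : Fin 4 → ℝ) :
    minkowskiForm (minkowskiReflection w x) (minkowskiReflection w y) = minkowskiForm x y := by
  simp only [minkowskiReflection_apply, minkowskiForm_sub_left, minkowskiForm_sub_right,
    minkowskiForm_smul_left, minkowskiForm_smul_right, minkowskiForm_comm x w]
  field_simp
  ring

lemma minkowskiReflection_involutive {w : Fin 4 → ℝ} (hw : minkowskiForm w w ≠ 0)
    (x : Fin 4 → ℝ) : minkowskiReflection w (minkowskiReflection w x) = x := by
  simp only [minkowskiReflection_apply, minkowskiForm_sub_right, minkowskiForm_smul_right]
  ext i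
  simp only [Pi.sub_apply, Pi.smul_apply, smul_eq_mul]
  field_simp
  ring

lemma minkowskiReflection_sub_apply {u v : Fin 4 → ℝ} (huv : minkowskiForm u u = minkowskiForm v v)
    (hw : minkowskiForm (u - v) (u - v) ≠ 0) : minkowskiReflection (u - v) u = v := by
  have h : 2 * minkowskiForm (u - v) u = minkowskiForm (u - v) (u - v) := by
    simp only [minkowskiForm_sub_left, minkowskiForm_sub_right, minkowskiForm_comm v u]
    linarith
  rw [minkowskiReflection_apply, h, div_self hw, one_smul, sub_sub_cancel]

lemma minkowskiForm_sub_self_ne_zero {f : (Fin 4 → ℝ) →ₗ[ℝ] (Fin 4 → ℝ)}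
    (hf : ∀ x y, minkowskiForm (f x) (f y) = minkowskiForm x y) {k : Fin 4}
    (hfix : ∀ j < k, f (Pi.single j 1) = Pi.single j 1)
    (hk : f (Pi.single k 1) ≠ Pi.single k 1) :
    minkowskiForm (f (Pi.single k 1) - Pi.single k 1) (f (Pi.single k 1) - Pi.single k 1) ≠ 0 := by
  intro h0
  apply hk
  rw [← sub_eq_zero]
  have hn := hf (Pi.single k 1) (Pi.single k 1)
  have hw0 : (f (Pi.single k 1) - Pi.single k 1 : Fin 4 → ℝ) 0 = 0 := by
    by_cases hk0 : k = 0
    · subst hk0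
      simp [minkowskiForm] at h0 hn ⊢
      nlinarith
    · have h1 := hf (Pi.single 0 1) (Pi.single k 1)
      rw [hfix 0 (Fin.pos_of_ne_zero hk0)] at h1
      simp [minkowskiForm, Ne.symm hk0] at h1 ⊢
      exact h1
  generalize f (Pi.single k 1) - Pi.single k 1 = w at h0 hw0
  simp only [minkowskiForm, hw0] at h0
  ext i
  fin_cases i
  · exact hw0
  all_goals
    simp only [Pi.zero_apply]
    apply pow_eq_zero_iff (n := 2) two_ne_zero |>.1
    simp
    nlinarith [sq_nonneg (w 1), sq_nonneg (w 2), sq_nonneg (w 3)]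

lemma lifts_of_fixes (n : ℕ) (hn : n ≤ 4) {f : (Fin 4 → ℝ) →ₗ[ℝ] (Fin 4 → ℝ)}
    (hf : ∀ x y, minkowskiForm (f x) (f y) = minkowskiForm x y)
    (hfix : ∀ j : Fin 4, (j : ℕ) + n < 4 → f (Pi.single j 1) = Pi.single j 1) : Lifts f := by
  induction n generalizing f with
  | zero =>
    convert lifts_id
    ext j : 2
    simp [hfix j (by omega)]
  | succ n ih =>
    let k : Fin 4 := ⟨3 - n, by omega⟩
    have hlt : ∀ j < k, f (Pi.single j 1) = Pi.single j 1 := fun j hj =>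
      hfix j (by have : (j : ℕ) < 3 - n := hj; omega)
    by_cases hk : f (Pi.single k 1) = Pi.single k 1
    · refine ih (by omega) hf fun j hj => ?_
      rcases eq_or_ne j k with rfl | hjk
      · exact hk
      · exact hlt j (lt_of_le_of_ne (show (j : ℕ) ≤ 3 - n by omega) hjk)
    · have hw := minkowskiForm_sub_self_ne_zero hf hlt hk
      set w := f (Pi.single k 1) - Pi.single k 1 with hwdef
      have hrf : Lifts (minkowskiReflection w ∘ₗ f) := by
        refine ih (by omega) (fun x y => ?_) fun j hj => ?_
        · simp only [LinearMap.comp_apply, minkowskiForm_minkowskiReflection hw, hf]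
        · rcases eq_or_ne j k with rfl | hjk
          · exact minkowskiReflection_sub_apply (hf _ _) hw
          · have hj' := hlt j (lt_of_le_of_ne (show (j : ℕ) ≤ 3 - n by omega) hjk)
            have horth : minkowskiForm w (Pi.single j 1) = 0 := by
              have h1 := hf (Pi.single k 1) (Pi.single j 1)
              rw [hj'] at h1
              rw [hwdef, minkowskiForm_sub_left, h1, sub_self]
            rw [LinearMap.comp_apply, hj', minkowskiReflection_apply, horth]
            simp
      convert (lifts_minkowskiReflection hw).comp hrf
      exact LinearMap.ext fun x => (minkowskiReflection_involutive hw (f x)).symm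

lemma lifts_of_lorentz {S : Matrix (Fin 4) (Fin 4) ℝ} (hS : Sᵀ * etaMink * S = etaMink) :
    Lifts S.mulVecLin := by
  have hform : ∀ x y, minkowskiForm x y = x ⬝ᵥ etaMink *ᵥ y := fun x y => by
    simp [minkowskiForm, etaMink, Matrix.mulVec, dotProduct, Fin.sum_univ_four]
    ring
  refine lifts_of_fixes 4 le_rfl (fun x y => ?_) fun j hj => by omega
  rw [hform, hform]
  conv_rhs => rw [← hS, ← Matrix.mulVec_mulVec, ← Matrix.mulVec_mulVec, Matrix.dotProduct_mulVec,
    Matrix.vecMul_transpose]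
  rfl

lemma slash_single (m : Fin 4) : slash (Pi.single m 1) = Dirac m := by
  simp [slash, Pi.single_apply]

lemma eq_smul_one_of_commute_dirac {M : Matrix (Fin 4) (Fin 4) ℂ}
    (h : ∀ m, Commute M (Dirac m)) : ∃ c : ℂ, M = c • 1 := by
  have h0 := fun i j => congrFun₂ (h 0).eq i j
  have h1 := fun i j => congrFun₂ (h 1).eq i j
  have h3 := fun i j => congrFun₂ (h 3).eq i j
  have h2 := fun i j => congrFun₂ (h 2).eq i j
  simp [Dirac, Matrix.mul_apply, Fin.sum_univ_four, Fin.forall_fin_succ] at h0 h1 h2 h3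
  have hI := I_ne_zero
  refine ⟨M 0 0, ?_⟩
  ext i j
  fin_cases i <;> fin_cases j <;> simp <;> grind

lemma eq_one_or_neg_one_of_mem {g : Matrix.GeneralLinearGroup (Fin 4) ℂ} (hg : g ∈ diracGroup)
    (h : ∀ m, Commute g.val (Dirac m)) : g.val = 1 ∨ g.val = -1 := by
  obtain ⟨c, hc⟩ := eq_smul_one_of_commute_dirac h
  obtain ⟨hdet, hq⟩ := det_eq_one_and_quaternionic_of_mem hg
  rw [hc] at hdet hq ⊢
  have hreal : star c = c := by
    simpa [quaternionicMatrix, Matrix.mul_apply, Fin.sum_univ_four] using congrFun₂ hq 0 3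
  obtain ⟨r, rfl⟩ := Complex.conj_eq_iff_real.1 hreal
  have hr : r ^ 4 = 1 := by
    simp at hdet
    exact_mod_cast hdet
  have hr' : r ^ 2 = 1 := by nlinarith [sq_nonneg r]
  rcases sq_eq_sq_iff_eq_or_eq_neg.1 (hr'.trans (one_pow 2).symm) with rfl | rfl <;> simp

/-- For every Lorentz matrix S there is Shat ∈ G with Shat γₘ Shat⁻¹ = Σₖ Sᵏₘ γₖ,
unique up to sign. -/
theorem stmt14 (S : Matrix (Fin 4) (Fin 4) ℝ) (hS : Sᵀ * etaMink * S = etaMink) :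
    ∃ Shat ∈ Subgroup.closure (genSet (Dirac 0) (Dirac 1 * Dirac 2 * Dirac 3)),
      (∀ m : Fin 4, Shat.val * Dirac m * (Shat⁻¹).val = ∑ k : Fin 4, (S k m : ℂ) • Dirac k) ∧
      ∀ Shat' ∈ Subgroup.closure (genSet (Dirac 0) (Dirac 1 * Dirac 2 * Dirac 3)),
        (∀ m : Fin 4, Shat'.val * Dirac m * (Shat'⁻¹).val = ∑ k : Fin 4, (S k m : ℂ) • Dirac k) →
        Shat'.val = Shat.val ∨ Shat'.val = -Shat.val := by
  obtain ⟨g, hg, hgS⟩ := lifts_of_lorentz hS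
  have hsum : ∀ m, ∑ k : Fin 4, (S k m : ℂ) • Dirac k = slash (S.mulVecLin (Pi.single m 1)) :=
    fun m => by simp [slash]
  have hrel : ∀ m, g.val * Dirac m * (g⁻¹).val = ∑ k : Fin 4, (S k m : ℂ) • Dirac k :=
    fun m => by rw [hsum, ← slash_single m, hgS, mul_assoc, Units.mul_inv, mul_one]
  refine ⟨g, hg, hrel, fun h hh hhS => ?_⟩
  have hcomm : ∀ m, Commute (g⁻¹ * h).val (Dirac m) := fun m => by
    have h1 := (hhS m).trans (hrel m).symm
    rw [Units.mul_inv_eq_iff_eq_mul] at h1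
    rw [Commute, SemiconjBy, Units.val_mul, mul_assoc, h1]
    simp only [← mul_assoc, Units.inv_mul, one_mul]
  have hgh : h.val = g.val * (g⁻¹ * h).val := by rw [← Units.val_mul, mul_inv_cancel_left]
  rcases eq_one_or_neg_one_of_mem (mul_mem (inv_mem hg) hh) hcomm with h1 | h1 <;>
    rw [hgh, h1] <;> simp
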